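/- arXiv:2307.14048 — 2 statements merged into one kernel-verified Lean document; each statement's English description precedes it below -/
import Mathlib

section
/- Let a ≥ 3 and d ≥ a(2^{12} − 1). Then q_d^{(a)}(n) ≥ Q_d^{(a)}(n) holds for all non-negative integers n, except: (1) n = d−a+3, n = d+3, or n = d+a+3 when d+3 is a multiple of a; and (2) n = d+a+3 when d+3 is not a multiple of a and a > 3. -/
/-- `qNum a d n` is the number of partitions of `n` into parts each at least `a`
in which any two parts differ by at least `d`. -/
noncomputable def qNum (a d n : ℕ) : ℕ :=
  Nat.card {p : n.Partition //
    (∀ x ∈ p.parts, a ≤ x) ∧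
    p.parts.Pairwise (fun x y => d ≤ max x y - min x y)}

/-- `QNum b d n` is the number of partitions of `n` into parts congruent to
`b` or `-b` modulo `d + 3`. -/
noncomputable def QNum (b d n : ℕ) : ℕ :=
  Nat.card {p : n.Partition //
    ∀ x ∈ p.parts, x % (d + 3) = b % (d + 3) ∨ (x + b) % (d + 3) = 0}

/-- Partitions counted by `qNum s d n` either avoid the part `s` or arise by adding `s` to a
partition of `n - s` into parts at least `s + d`. -/
theorem qNum_succ_add_qNum_le {s n : ℕ} (d : ℕ) (hs : 0 < s) (hn : s ≤ n) :
    qNum (s + 1) d n + qNum (s + d) d (n - s) ≤ qNum s d n := by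
  unfold qNum
  rw [← Nat.card_sum]
  refine Nat.card_le_card_of_injective (Sum.elim
    (fun p => ⟨p.1, fun x hx => (Nat.le_succ s).trans (p.2.1 x hx), p.2.2⟩)
    (fun p => ⟨⟨s ::ₘ p.1.parts, ?_, ?_⟩, ?_, ?_⟩)) ?_
  · intro i hi
    rcases Multiset.mem_cons.1 hi with rfl | h
    · exact hs
    · exact p.1.parts_pos h
  · rw [Multiset.sum_cons, p.1.parts_sum]
    omega
  · intro x hx
    rcases Multiset.mem_cons.1 hx with rfl | h
    · exact le_rfl
    · exact (Nat.le_add_right s d).trans (p.2.1 x h)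
  · obtain ⟨l, hl, hp⟩ := p.2.2
    refine ⟨s :: l, congrArg (s ::ₘ ·) hl, List.pairwise_cons.2 ⟨fun y hy => ?_, hp⟩⟩
    have := p.2.1 y (by rw [hl]; exact hy)
    omega
  · rintro (⟨p, hp⟩ | ⟨p, hp⟩) (⟨q, hq⟩ | ⟨q, hq⟩) h
    · simpa using h
    · exfalso
      simp only [Sum.elim_inl, Sum.elim_inr, Subtype.mk.injEq] at h
      have := hp.1 s (by rw [h]; simp)
      omega
    · exfalso
      simp only [Sum.elim_inl, Sum.elim_inr, Subtype.mk.injEq] at h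
      have := hq.1 s (by rw [← h]; simp)
      omega
    · simp only [Sum.elim_inr, Subtype.mk.injEq, Nat.Partition.mk.injEq,
        Multiset.cons_inj_right] at h
      simp only [Sum.inr.injEq, Subtype.mk.injEq]
      exact Nat.Partition.ext h

theorem qNum_add_sum_le {s n : ℕ} (d G : ℕ) (hs : 0 < s) (hn : s + G ≤ n) :
    qNum (s + G) d n + ∑ g ∈ Finset.range G, qNum (s + g + d) d (n - (s + g)) ≤ qNum s d n := by
  induction G with
  | zero => simp
  | succ G ih =>
    have h1 := ih (by omega)
    have h2 := qNum_succ_add_qNum_le d (show 0 < s + G by omega) (show s + G ≤ n by omega)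
    rw [Finset.sum_range_succ, ← add_assoc s G 1]
    omega

theorem one_le_qNum {s n : ℕ} (d : ℕ) (hs : 0 < s) (hn : s ≤ n) : 1 ≤ qNum s d n := by
  unfold qNum
  have : Nonempty {p : n.Partition // (∀ x ∈ p.parts, s ≤ x) ∧
      p.parts.Pairwise (fun x y => d ≤ max x y - min x y)} := by
    refine ⟨⟨⟨{n}, fun {i} hi => ?_, by simp⟩, ?_, ⟨[n], rfl, by simp⟩⟩⟩
    · rw [Multiset.mem_singleton.1 hi]
      omega
    · intro x hx
      rw [Multiset.mem_singleton.1 hx]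
      exact hn
  exact Nat.card_pos

theorem one_le_qNum_zero (s d : ℕ) : 1 ≤ qNum s d 0 := by
  unfold qNum
  have : Nonempty {p : (0 : ℕ).Partition // (∀ x ∈ p.parts, s ≤ x) ∧
      p.parts.Pairwise (fun x y => d ≤ max x y - min x y)} :=
    ⟨⟨⟨0, by simp, by simp⟩, by simp, ⟨[], rfl, by simp⟩⟩⟩
  exact Nat.card_pos

theorem two_le_qNum {a d n : ℕ} (ha : 0 < a) (hn : d + 2 * a ≤ n) (hna : a < n) :
    2 ≤ qNum a d n := by
  have h1 := qNum_succ_add_qNum_le d ha (show a ≤ n by omega)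
  have h2 := one_le_qNum d (show 0 < a + 1 by omega) (show a + 1 ≤ n by omega)
  have h3 := one_le_qNum d (show 0 < a + d by omega) (show a + d ≤ n - a by omega)
  omega

theorem three_le_qNum {a d n : ℕ} (ha : 0 < a) (hn : d + 2 * a + 2 ≤ n) : 3 ≤ qNum a d n := by
  have h1 := qNum_succ_add_qNum_le d ha (show a ≤ n by omega)
  have h2 := two_le_qNum (d := d) (show 0 < a + 1 by omega) (show d + 2 * (a + 1) ≤ n by omega)
    (by omega)
  have h3 := one_le_qNum d (show 0 < a + d by omega) (show a + d ≤ n - a by omega)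
  omega

/-- Partitions with `r + 1` parts whose smallest part and first `r - 1` gaps exceed their minimal
values by less than `G`. -/
theorem pow_le_qNum (d G r : ℕ) {s n : ℕ} (hs : 0 < s)
    (hn : 2 * (r + 1) * s + d * (r * (r + 1)) + G * (r * (r + 3)) ≤ 2 * n) :
    G ^ r ≤ qNum s d n := by
  induction r generalizing s n with
  | zero => simpa using one_le_qNum d hs (by linarith)
  | succ r ih =>
    have hsG : s + G ≤ n := by
      nlinarith [Nat.zero_le (r * s), Nat.zero_le (d * ((r + 1) * (r + 1 + 1))),
        Nat.zero_le (G * r), Nat.zero_le (G * r ^ 2)]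
    have key : ∀ g ∈ Finset.range G, G ^ r ≤ qNum (s + g + d) d (n - (s + g)) := by
      intro g hg
      have hg := Finset.mem_range.1 hg
      refine ih (by omega) ?_
      zify [show s + g ≤ n by omega] at hn hg ⊢
      nlinarith
    calc G ^ (r + 1) = ∑ _g ∈ Finset.range G, G ^ r := by
          rw [Finset.sum_const, Finset.card_range, smul_eq_mul, pow_succ']
      _ ≤ _ := Finset.sum_le_sum key
      _ ≤ _ := (Nat.le_add_left _ _).trans (qNum_add_sum_le d G hs hsG)

/-- The Chernoff bound for the number of multisets with parts among the `w i` and sum at most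
`n`. -/
theorem card_le_prod_of_sum_le {ι : Type*} [DecidableEq ι] (w : ι → ℕ) (I : Finset ι)
    (hw : ∀ i ∈ I, 0 < w i) {x : ℝ} (hx0 : 0 < x) (hx1 : x < 1) (n : ℕ)
    (T : Finset (Multiset ℕ)) (hT : ∀ m ∈ T, (∀ y ∈ m, ∃ i ∈ I, y = w i) ∧ m.sum ≤ n) :
    (T.card : ℝ) * x ^ n ≤ ∏ i ∈ I, (1 - x ^ w i)⁻¹ := by
  induction I using Finset.induction_on generalizing n T with
  | empty =>
    have hT0 : T ⊆ {0} := by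
      intro m hm
      rw [Finset.mem_singleton]
      refine Multiset.eq_zero_of_forall_notMem fun y hy => ?_
      simpa using (hT m hm).1 y hy
    have hc : (T.card : ℝ) ≤ 1 := by exact_mod_cast Finset.card_le_card hT0
    have hp : x ^ n ≤ 1 := pow_le_one₀ hx0.le hx1.le
    have : 0 < x ^ n := by positivity
    rw [Finset.prod_empty]
    nlinarith
  | insert i I hi ih =>
    rw [Finset.prod_insert hi]
    have hwi : 0 < w i := hw i (Finset.mem_insert_self i I)
    have ih := ih fun j hj => hw j (Finset.mem_insert_of_mem hj)
    set P := ∏ j ∈ I, (1 - x ^ w j)⁻¹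
    have hu1 : x ^ w i < 1 := pow_lt_one₀ hx0.le hx1 hwi.ne'
    have hP : 0 ≤ P := Finset.prod_nonneg fun j _ =>
      inv_nonneg.2 (sub_nonneg.2 (pow_le_one₀ hx0.le hx1.le))
    induction n using Nat.strong_induction_on generalizing T with
    | _ n ihn =>
      set T₀ := T.filter fun m => w i ∉ m
      set T₁ := T.filter fun m => ¬ w i ∉ m
      have hcard : T.card = T₀.card + T₁.card :=
        (Finset.card_filter_add_card_filter_not _).symm
      have h0 : (T₀.card : ℝ) * x ^ n ≤ P := by
        refine ih n T₀ fun m hm => ?_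
        obtain ⟨hmT, hmi⟩ := Finset.mem_filter.1 hm
        refine ⟨fun y hy => ?_, (hT m hmT).2⟩
        obtain ⟨j, hj, rfl⟩ := (hT m hmT).1 y hy
        rcases Finset.mem_insert.1 hj with rfl | hj
        · exact absurd hy hmi
        · exact ⟨j, hj, rfl⟩
      have h1 : (T₁.card : ℝ) * x ^ n ≤ x ^ w i * ((1 - x ^ w i)⁻¹ * P) := by
        have hsub : 0 < 1 - x ^ w i := by linarith
        have hnn : 0 ≤ x ^ w i * ((1 - x ^ w i)⁻¹ * P) := by positivity
        rcases T₁.eq_empty_or_nonempty with he | ⟨m₀, hm₀⟩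
        · simpa [he] using hnn
        have hmem : ∀ m ∈ T₁, m ∈ T ∧ w i ∈ m := fun m hm => by
          simpa [T₁] using hm
        have hle : w i ≤ n :=
          (Multiset.le_sum_of_mem (hmem m₀ hm₀).2).trans (hT m₀ (hmem m₀ hm₀).1).2
        have hinj : Set.InjOn (fun m : Multiset ℕ => m.erase (w i)) T₁ := by
          intro m hm m' hm' h
          rw [← Multiset.cons_erase (hmem m hm).2, ← Multiset.cons_erase (hmem m' hm').2]
          exact congrArg _ h
        have := ihn (n - w i) (by omega) (T₁.image fun m => m.erase (w i)) (by
          intro m hm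
          obtain ⟨m', hm', rfl⟩ := Finset.mem_image.1 hm
          obtain ⟨hmT, hmi⟩ := hmem m' hm'
          refine ⟨fun y hy => (hT m' hmT).1 y (Multiset.mem_of_mem_erase hy), ?_⟩
          have hs := (hT m' hmT).2
          rw [← Multiset.cons_erase hmi, Multiset.sum_cons] at hs
          omega)
        rw [Finset.card_image_of_injOn hinj] at this
        calc (T₁.card : ℝ) * x ^ n = x ^ w i * (T₁.card * x ^ (n - w i)) := by
              rw [← pow_mul_pow_sub x hle]
              ring
          _ ≤ _ := by gcongr
      have hsub : 1 - x ^ w i ≠ 0 := by linarith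
      calc (T.card : ℝ) * x ^ n = T₀.card * x ^ n + T₁.card * x ^ n := by
            rw [hcard]
            push_cast
            ring
        _ ≤ P + x ^ w i * ((1 - x ^ w i)⁻¹ * P) := add_le_add h0 h1
        _ = (1 - x ^ w i)⁻¹ * P := by
            field_simp
            ring

theorem prod_inv_one_sub_exp_neg_le (K : ℕ) {t : ℝ} (ht : 0 < t) :
    ∏ k ∈ Finset.Icc 1 K, (1 - Real.exp (-t) ^ k)⁻¹ ≤ Real.exp (2 / t) := by
  set y := Real.exp (-t)
  have hy0 : 0 < y := Real.exp_pos _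
  have hy1 : y < 1 := Real.exp_lt_one_iff.2 (by linarith)
  have hlt : ∀ k ∈ Finset.Icc 1 K, y ^ k < 1 := fun k hk =>
    pow_lt_one₀ hy0.le hy1 (by have := Finset.mem_Icc.1 hk; omega)
  have hsum : HasSum (fun j : ℕ => ∑ k ∈ Finset.Icc 1 K, (y ^ k) ^ (j + 1) / ((j : ℝ) + 1))
      (∑ k ∈ Finset.Icc 1 K, -Real.log (1 - y ^ k)) :=
    hasSum_sum fun k hk => Real.hasSum_pow_div_log_of_abs_lt_one (by
      rw [abs_of_pos (by positivity)]
      exact hlt k hk)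
  have hgeom : ∀ j : ℕ, ((j : ℝ) + 1) * t * ∑ k ∈ Finset.Icc 1 K, (y ^ k) ^ (j + 1) ≤ 1 := by
    intro j
    have hz0 : 0 < y ^ (j + 1) := by positivity
    have hz : y ^ (j + 1) * (1 + ((j : ℝ) + 1) * t) ≤ 1 := by
      have h := Real.add_one_le_exp (((j : ℝ) + 1) * t)
      have h2 : y ^ (j + 1) * Real.exp (((j : ℝ) + 1) * t) = 1 := by
        rw [← Real.exp_nat_mul, ← Real.exp_add]
        push_cast
        simp
      nlinarith
    have hs : ∀ K : ℕ, (∑ k ∈ Finset.Icc 1 K, (y ^ k) ^ (j + 1)) * (1 - y ^ (j + 1)) =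
        y ^ (j + 1) * (1 - (y ^ (j + 1)) ^ K) := by
      intro K
      induction K with
      | zero => simp
      | succ K ih =>
        rw [Finset.sum_Icc_succ_top (by omega), add_mul, ih]
        rw [← pow_mul y (K + 1), mul_comm (K + 1), pow_mul]
        ring
    have hS := hs K
    set S := ∑ k ∈ Finset.Icc 1 K, (y ^ k) ^ (j + 1)
    have hS0 : 0 ≤ S := Finset.sum_nonneg fun k _ => by positivity
    have hzK : 0 ≤ (y ^ (j + 1)) ^ K := by positivity
    set z := y ^ (j + 1)
    have hSz : S * (1 - z) ≤ z := by rw [hS]; nlinarith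
    have h3 : z * ((j + 1) * t * S) ≤ z * 1 := by nlinarith
    exact le_of_mul_le_mul_left h3 hz0
  have hzeta : HasSum (fun j : ℕ => t⁻¹ * (1 / ((j + 1 : ℕ) : ℝ) ^ 2))
      (t⁻¹ * (Real.pi ^ 2 / 6)) := by
    refine HasSum.mul_left _ ?_
    have := (hasSum_nat_add_iff' 1).2 hasSum_zeta_two
    simpa using this
  have hle : ∑ k ∈ Finset.Icc 1 K, -Real.log (1 - y ^ k) ≤ t⁻¹ * (Real.pi ^ 2 / 6) := by
    refine hasSum_le (fun j => ?_) hsum hzeta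
    rw [← Finset.sum_div]
    push_cast
    have hj : (0 : ℝ) < (j : ℝ) + 1 := by positivity
    rw [div_le_iff₀ hj]
    have := hgeom j
    have e : t⁻¹ * (1 / ((j : ℝ) + 1) ^ 2) * ((j : ℝ) + 1) = 1 / (((j : ℝ) + 1) * t) := by
      field_simp
    rw [e, le_div_iff₀ (by positivity)]
    linarith
  have hpi : Real.pi ^ 2 / 6 ≤ 2 := by nlinarith [Real.pi_lt_d2, Real.pi_pos]
  have hfin : ∑ k ∈ Finset.Icc 1 K, -Real.log (1 - y ^ k) ≤ 2 / t := by
    rw [div_eq_inv_mul]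
    exact hle.trans (mul_le_mul_of_nonneg_left hpi (by positivity))
  calc ∏ k ∈ Finset.Icc 1 K, (1 - y ^ k)⁻¹
      = Real.exp (∑ k ∈ Finset.Icc 1 K, -Real.log (1 - y ^ k)) := by
        rw [Real.exp_sum]
        refine Finset.prod_congr rfl fun k hk => ?_
        rw [Real.exp_neg, Real.exp_log (by linarith [hlt k hk])]
    _ ≤ _ := Real.exp_le_exp.2 hfin

/-- Partitions counted by `QNum a d n` are determined by their parts other than `a`. -/
theorem exists_finset_card_eq_QNum {a d : ℕ} (n : ℕ) (ha : 0 < a) (had : a < d + 3) :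
    ∃ T : Finset (Multiset ℕ), T.card = QNum a d n ∧ ∀ m ∈ T,
      (∀ y ∈ m, y ≤ n ∧ ∃ k, 1 ≤ k ∧ (y = k * (d + 3) - a ∨ y = k * (d + 3) + a)) ∧
      m.sum ≤ n ∧ a ∣ n - m.sum := by
  classical
  let A := {p : n.Partition //
    ∀ x ∈ p.parts, x % (d + 3) = a % (d + 3) ∨ (x + a) % (d + 3) = 0}
  let f : A → Multiset ℕ := fun p => p.1.parts.filter (· ≠ a)
  have hparts : ∀ p : A,
      p.1.parts = f p + Multiset.replicate (p.1.parts.count a) a := fun p => by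
    have h := Multiset.filter_add_not (· = a) p.1.parts
    rw [Multiset.filter_eq', add_comm] at h
    exact h.symm
  have hsum : ∀ p : A, n = (f p).sum + p.1.parts.count a * a := fun p => by
    have h := congrArg Multiset.sum (hparts p)
    rwa [p.1.parts_sum, Multiset.sum_add, Multiset.sum_replicate, smul_eq_mul] at h
  have hinj : Function.Injective f := by
    intro p q h
    have h1 := hsum p
    have h2 := hsum q
    rw [h] at h1
    have h3 : p.1.parts.count a = q.1.parts.count a :=
      Nat.eq_of_mul_eq_mul_right ha (by omega)
    refine Subtype.ext (Nat.Partition.ext ?_)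
    rw [hparts p, hparts q, h, h3]
  refine ⟨Finset.univ.image f, ?_, fun m hm => ?_⟩
  · rw [Finset.card_image_of_injective _ hinj, Finset.card_univ, ← Nat.card_eq_fintype_card]
    rfl
  · obtain ⟨p, -, rfl⟩ := Finset.mem_image.1 hm
    have hp := hsum p
    refine ⟨fun y hy => ?_, by omega, ⟨p.1.parts.count a, ?_⟩⟩
    · obtain ⟨hy, hya⟩ := Multiset.mem_filter.1 hy
      refine ⟨p.1.parts_sum ▸ Multiset.le_sum_of_mem hy, ?_⟩
      have hypos := p.1.parts_pos hy
      rcases p.2 y hy with h | h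
      · rw [Nat.mod_eq_of_lt had] at h
        refine ⟨y / (d + 3), ?_, Or.inr ?_⟩
        · by_contra h0
          have h1 := Nat.div_add_mod y (d + 3)
          rw [Nat.eq_zero_of_not_pos h0, mul_zero, zero_add] at h1
          exact hya (by omega)
        · rw [← h]
          exact (Nat.div_add_mod' y (d + 3)).symm
      · obtain ⟨k, hk⟩ := Nat.dvd_of_mod_eq_zero h
        refine ⟨k, ?_, Or.inl ?_⟩
        · rcases k with _ | k
          · omega
          · omega
        · rw [mul_comm, ← hk]
          omega
    · rw [mul_comm]
      omega

theorem QNum_le_exp {a d n k : ℕ} (ha : 0 < a) (had : a < d + 3) (hk : 0 < k)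
    (hn : n ≤ k ^ 2 * (d + 3 - a)) : (QNum a d n : ℝ) ≤ Real.exp (4 * k) := by
  obtain ⟨T, hcard, hT⟩ := exists_finset_card_eq_QNum n ha had
  rw [← hcard]
  set N := d + 3 - a with hN
  have hNpos : 0 < N := by omega
  have hkR : (0 : ℝ) < k := by exact_mod_cast hk
  have hNR : (0 : ℝ) < N := by exact_mod_cast hNpos
  set t : ℝ := 2 / k with ht
  have ht0 : 0 < t := by positivity
  set x := Real.exp (-(t / N)) with hx
  have hx0 : 0 < x := Real.exp_pos _
  have hx1 : x < 1 := Real.exp_lt_one_iff.2 (neg_lt_zero.2 (by positivity))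
  have hxN : x ^ N = Real.exp (-t) := by
    rw [hx, ← Real.exp_nat_mul]
    congr 1
    field_simp
  let w : ℕ × Bool → ℕ := fun i => bif i.2 then i.1 * (d + 3) - a else i.1 * (d + 3) + a
  have hwN : ∀ i : ℕ × Bool, 1 ≤ i.1 → N * i.1 ≤ w i := by
    rintro ⟨j, b⟩ hj
    have h1 : N * j + a * j = j * (d + 3) := by
      rw [← add_mul, mul_comm]
      congr 1
      omega
    have h2 : a ≤ a * j := Nat.le_mul_of_pos_right a hj
    cases b <;> simp only [w, cond_true, cond_false] <;> omega
  have hmain := card_le_prod_of_sum_le w (Finset.Icc 1 n ×ˢ Finset.univ) (fun i hi => by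
      have h1 : 1 ≤ i.1 := (Finset.mem_Icc.1 (Finset.mem_product.1 hi).1).1
      exact lt_of_lt_of_le (Nat.mul_pos hNpos h1) (hwN i h1)) hx0 hx1 n T (fun m hm => by
      refine ⟨fun y hy => ?_, (hT m hm).2.1⟩
      obtain ⟨hyn, j, hj, h⟩ := (hT m hm).1 y hy
      have hjn : j ≤ n := by
        have h1 := hwN (j, true) hj
        have h2 := hwN (j, false) hj
        have h3 : j ≤ N * j := Nat.le_mul_of_pos_left j hNpos
        simp only [w, cond_true, cond_false] at h1 h2
        omega
      rcases h with h | h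
      · exact ⟨(j, true), by simp [hj, hjn], h⟩
      · exact ⟨(j, false), by simp [hj, hjn], h⟩)
  have hprod : ∏ i ∈ Finset.Icc 1 n ×ˢ (Finset.univ : Finset Bool), (1 - x ^ w i)⁻¹ ≤
      Real.exp (2 * k) := by
    calc ∏ i ∈ Finset.Icc 1 n ×ˢ (Finset.univ : Finset Bool), (1 - x ^ w i)⁻¹
        ≤ ∏ i ∈ Finset.Icc 1 n ×ˢ (Finset.univ : Finset Bool), (1 - Real.exp (-t) ^ i.1)⁻¹ := by
          refine Finset.prod_le_prod (fun i _ => inv_nonneg.2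
            (sub_nonneg.2 (pow_le_one₀ hx0.le hx1.le))) fun i hi => ?_
          have h1 : 1 ≤ i.1 := (Finset.mem_Icc.1 (Finset.mem_product.1 hi).1).1
          have hlt : Real.exp (-t) ^ i.1 < 1 :=
            pow_lt_one₀ (Real.exp_pos _).le (Real.exp_lt_one_iff.2 (by linarith)) (by omega)
          have hle : x ^ w i ≤ Real.exp (-t) ^ i.1 := by
            rw [← hxN, ← pow_mul]
            exact pow_le_pow_of_le_one hx0.le hx1.le (hwN i h1)
          exact inv_anti₀ (by linarith) (by linarith)
      _ = (∏ j ∈ Finset.Icc 1 n, (1 - Real.exp (-t) ^ j)⁻¹) ^ 2 := by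
          rw [Finset.prod_product, ← Finset.prod_pow]
          refine Finset.prod_congr rfl fun j _ => ?_
          simp
      _ ≤ Real.exp (2 / t) ^ 2 := by
          refine pow_le_pow_left₀ (Finset.prod_nonneg fun j _ => inv_nonneg.2 (sub_nonneg.2
            (pow_le_one₀ (Real.exp_pos _).le (Real.exp_le_one_iff.2 (by linarith))))) ?_ 2
          exact prod_inv_one_sub_exp_neg_le n ht0
      _ = Real.exp (2 * k) := by
          rw [← Real.exp_nat_mul, ht]
          congr 1
          field_simp
          norm_num
  have hxn : Real.exp (-(2 * k)) ≤ x ^ n := by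
    rw [hx, ← Real.exp_nat_mul, Real.exp_le_exp, ht]
    have hnR : (n : ℝ) ≤ k ^ 2 * N := by exact_mod_cast hn
    have : (n : ℝ) * (2 / k / N) ≤ 2 * k := by
      rw [div_div, mul_div_assoc', div_le_iff₀ (by positivity)]
      nlinarith
    linarith
  have hfin : (T.card : ℝ) * Real.exp (-(2 * k)) ≤ Real.exp (2 * k) :=
    (mul_le_mul_of_nonneg_left hxn (by positivity)).trans (hmain.trans hprod)
  calc (T.card : ℝ) = T.card * Real.exp (-(2 * k)) * Real.exp (2 * k) := by
        rw [mul_assoc, ← Real.exp_add]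
        simp
    _ ≤ Real.exp (2 * k) * Real.exp (2 * k) := by gcongr
    _ = Real.exp (4 * k) := by
        rw [← Real.exp_add]
        congr 1
        ring

theorem QNum_le_pow {a d n k : ℕ} (ha : 0 < a) (had : a < d + 3) (hk : 0 < k)
    (hn : n ≤ k ^ 2 * (d + 3 - a)) : QNum a d n ≤ 55 ^ k := by
  have he : Real.exp 4 ≤ 55 := by
    have h : Real.exp 4 = Real.exp 1 ^ 4 := by
      rw [← Real.exp_nat_mul]
      norm_num
    rw [h]
    calc Real.exp 1 ^ 4 ≤ 2.7182818286 ^ 4 :=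
          pow_le_pow_left₀ (Real.exp_pos 1).le Real.exp_one_lt_d9.le 4
      _ ≤ 55 := by norm_num
  have : (QNum a d n : ℝ) ≤ 55 ^ k := by
    refine (QNum_le_exp ha had hk hn).trans ?_
    rw [mul_comm, Real.exp_nat_mul]
    exact pow_le_pow_left₀ (Real.exp_pos 4).le he k
  exact_mod_cast this

theorem QNum_le_of_lt {a d n : ℕ} (ha : 0 < a) (had : 3 * a < d + 3)
    (hn : n < 2 * (d + 3 - a)) :
    QNum a d n ≤ (if a ∣ n then 1 else 0) +
      (if d + 3 - a ≤ n ∧ a ∣ n - (d + 3 - a) then 1 else 0) +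
      (if d + 3 + a ≤ n ∧ a ∣ n - (d + 3 + a) then 1 else 0) := by
  obtain ⟨T, hcard, hT⟩ := exists_finset_card_eq_QNum n ha (show a < d + 3 by omega)
  have hpart : ∀ m ∈ T, ∀ y ∈ m, y = d + 3 - a ∨ y = d + 3 + a := by
    intro m hm y hy
    obtain ⟨hyn, k, hk, h⟩ := (hT m hm).1 y hy
    have hk2 : k < 2 := by
      by_contra hcon
      have : 2 * (d + 3) ≤ k * (d + 3) := Nat.mul_le_mul_right _ (by omega)
      omega
    obtain rfl : k = 1 := by omega
    simpa using h
  have hsub : T ⊆ (if a ∣ n then {0} else ∅) ∪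
      (if d + 3 - a ≤ n ∧ a ∣ n - (d + 3 - a) then {{d + 3 - a}} else ∅) ∪
      (if d + 3 + a ≤ n ∧ a ∣ n - (d + 3 + a) then {{d + 3 + a}} else ∅) := by
    intro m hm
    obtain ⟨-, hle, hdvd⟩ := hT m hm
    have hpm := hpart m hm
    induction m using Multiset.induction_on with
    | empty =>
      have : a ∣ n := by simpa using hdvd
      simp [this]
    | cons y m _ =>
      have hm0 : m = 0 := by
        refine Multiset.eq_zero_of_forall_notMem fun z hz => ?_
        have h1 := hpm y (Multiset.mem_cons_self y m)
        have h2 := hpm z (Multiset.mem_cons_of_mem hz)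
        have h3 := Multiset.le_sum_of_mem hz
        rw [Multiset.sum_cons] at hle
        omega
      subst hm0
      simp only [Multiset.sum_cons, Multiset.sum_zero, add_zero] at hle hdvd
      rcases hpm y (Multiset.mem_cons_self y 0) with rfl | rfl
      · simp [hle, hdvd]
      · simp [hle, hdvd]
  rw [← hcard]
  refine (Finset.card_le_card hsub).trans ((Finset.card_union_le _ _).trans
    (add_le_add ((Finset.card_union_le _ _).trans (add_le_add ?_ ?_)) ?_)) <;>
  split_ifs <;> simp

theorem QNum_le_qNum_of_lt {a d n : ℕ} (ha : 3 ≤ a) (had : 5 * a ≤ d)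
    (h1 : ¬ (a ∣ d + 3 ∧ (n = d - a + 3 ∨ n = d + 3 ∨ n = d + a + 3)))
    (h2 : ¬ (¬ a ∣ d + 3 ∧ 3 < a ∧ n = d + a + 3)) (hn : n < 2 * (d + 3 - a)) :
    QNum a d n ≤ qNum a d n := by
  have hQ := QNum_le_of_lt (show 0 < a by omega) (show 3 * a < d + 3 by omega) hn
  have dvd_add {b c : ℕ} (hc : b ≤ c) (hb : a ∣ c - b) : (a ∣ c ↔ a ∣ b) := by
    rw [← Nat.sub_add_cancel hc]
    exact (Nat.dvd_add_right hb)
  have e1 : a ∣ d + 3 - a ↔ a ∣ d + 3 := by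
    conv_rhs => rw [← Nat.sub_add_cancel (show a ≤ d + 3 by omega)]
    exact (Nat.dvd_add_left (dvd_refl a)).symm
  have e2 : a ∣ d + 3 + a ↔ a ∣ d + 3 := Nat.dvd_add_left (dvd_refl a)
  by_cases hbig : d + 2 * a + 2 ≤ n
  · have := three_le_qNum (show 0 < a by omega) hbig
    split_ifs at hQ <;> omega
  by_cases hN : n < d + 3 - a
  · rw [if_neg (by omega : ¬ (d + 3 - a ≤ n ∧ _)),
      if_neg (by omega : ¬ (d + 3 + a ≤ n ∧ _))] at hQ
    rcases Nat.eq_zero_or_pos n with rfl | hpos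
    · have := one_le_qNum_zero a d
      split_ifs at hQ <;> omega
    by_cases hdvd : a ∣ n
    · have := one_le_qNum d (show 0 < a by omega) (Nat.le_of_dvd hpos hdvd)
      split_ifs at hQ; omega
    · rw [if_neg hdvd] at hQ
      omega
  have hq1 := one_le_qNum d (show 0 < a by omega) (show a ≤ n by omega)
  have hdvd1 : d + 3 - a ≤ n ∧ a ∣ n - (d + 3 - a) → (a ∣ n ↔ a ∣ d + 3) := fun h =>
    (dvd_add h.1 h.2).trans e1
  have hdvd2 : d + 3 + a ≤ n ∧ a ∣ n - (d + 3 + a) → (a ∣ n ↔ a ∣ d + 3) := fun h =>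
    (dvd_add h.1 h.2).trans e2
  by_cases hN3 : a ∣ d + 3 <;> by_cases hdvd : a ∣ n
  · exfalso
    obtain ⟨e, he⟩ := hN3
    obtain ⟨c, rfl⟩ := hdvd
    have hce : c < e + 2 := by
      by_contra hcon
      have := Nat.mul_le_mul_left a (Nat.le_of_not_lt hcon)
      rw [mul_add] at this
      omega
    have hec : e ≤ c + 1 := by
      by_contra hcon
      have := Nat.mul_le_mul_left a (show c + 2 ≤ e by omega)
      rw [mul_add] at this
      omega
    refine h1 ⟨⟨e, he⟩, ?_⟩
    obtain rfl | rfl | rfl : e = c + 1 ∨ c = e ∨ c = e + 1 := by omega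
    · rw [mul_add] at he
      omega
    · omega
    · rw [mul_add]
      omega
  · rw [if_neg hdvd, if_neg fun h => hdvd ((hdvd1 h).2 hN3),
      if_neg fun h => hdvd ((hdvd2 h).2 hN3)] at hQ
    omega
  · rw [if_neg fun h => hN3 ((hdvd1 h).1 hdvd), if_neg fun h => hN3 ((hdvd2 h).1 hdvd)] at hQ
    split_ifs at hQ; omega
  · rw [if_neg hdvd] at hQ
    by_cases hmid : d + 2 * a ≤ n
    · have := two_le_qNum (show 0 < a by omega) hmid (by omega)
      split_ifs at hQ <;> omega
    · have : ¬ (d + 3 + a ≤ n ∧ a ∣ n - (d + 3 + a)) := by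
        rintro ⟨hle, hd⟩
        have := Nat.eq_zero_of_dvd_of_lt hd (by omega)
        exact h2 ⟨hN3, by omega, by omega⟩
      rw [if_neg this] at hQ
      split_ifs at hQ <;> omega

theorem QNum_le_qNum_of_le {a d n : ℕ} (ha : 3 ≤ a) (hd : 4095 * a ≤ d)
    (hn : 2 * (d + 3 - a) ≤ n) : QNum a d n ≤ qNum a d n := by
  have ha0 : 0 < a := by omega
  have had : a < d + 3 := by omega
  by_cases h2 : n ≤ 2 ^ 2 * (d + 3 - a)
  · calc QNum a d n ≤ 3025 ^ 1 := QNum_le_pow ha0 had two_pos h2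
      _ ≤ qNum a d n := pow_le_qNum d 3025 1 ha0 (by omega)
  have hex : ∃ k, n ≤ k ^ 2 * (d + 3 - a) := ⟨n, by
    have : 1 ≤ d + 3 - a := by omega
    nlinarith⟩
  obtain ⟨k, hk, hmin⟩ : ∃ k, n ≤ k ^ 2 * (d + 3 - a) ∧
      ∀ j < k, ¬ n ≤ j ^ 2 * (d + 3 - a) :=
    ⟨Nat.find hex, Nat.find_spec hex, fun _ => Nat.find_min hex⟩
  have hk3 : 3 ≤ k := by
    by_contra hcon
    refine h2 (hk.trans (Nat.mul_le_mul_right _ (Nat.pow_le_pow_left ?_ 2)))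
    omega
  obtain ⟨j, rfl⟩ := Nat.exists_eq_add_of_le' hk3
  have hlow := hmin (j + 2) (by omega)
  calc QNum a d n ≤ 55 ^ (j + 3) := QNum_le_pow ha0 had (by omega) hk
    _ = 55 ^ j * 55 ^ 3 := pow_add _ _ _
    _ ≤ 1000 ^ j * 1000 ^ 2 :=
        Nat.mul_le_mul (Nat.pow_le_pow_left (by norm_num) j) (by norm_num)
    _ = 1000 ^ (j + 2) := (pow_add _ _ _).symm
    _ ≤ qNum a d n := by
        refine pow_le_qNum d 1000 (j + 2) ha0 ?_
        obtain ⟨e, rfl⟩ := Nat.exists_eq_add_of_le hd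
        obtain ⟨b, rfl⟩ := Nat.exists_eq_add_of_le ha
        rw [show 4095 * (3 + b) + e + 3 - (3 + b) = 4094 * (3 + b) + e + 3 by omega] at hlow
        push Not at hlow
        nlinarith [Nat.zero_le (j ^ 2 * b), Nat.zero_le (j ^ 2 * e), Nat.zero_le (j * b),
          Nat.zero_le (j * e), Nat.zero_le (j ^ 2)]

theorem alder_general_level (a d n : ℕ) (ha : 3 ≤ a) (hd : a * (2 ^ 12 - 1) ≤ d)
    (h1 : ¬ (a ∣ d + 3 ∧ (n = d - a + 3 ∨ n = d + 3 ∨ n = d + a + 3)))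
    (h2 : ¬ (¬ a ∣ d + 3 ∧ 3 < a ∧ n = d + a + 3)) :
    QNum a d n ≤ qNum a d n := by
  rcases lt_or_ge n (2 * (d + 3 - a)) with hn | hn
  · exact QNum_le_qNum_of_lt ha (by omega) h1 h2 hn
  · exact QNum_le_qNum_of_le ha (by omega) hn
end

section
/- Let d > 127 with d not of the form 2^r − 1 for any integer r. Then for all integers n ≥ d+4, q_d^{(1)}(n) ≥ Q_{d−2}^{(1)}(n). -/
/-- Splitting off the possible part `a` from the partitions counted by `qNum a d n`. -/
theorem qNum_succ_add_le {a d n : ℕ} (ha : 1 ≤ a) (hd : 1 ≤ d) (han : a ≤ n) :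
    qNum (a + 1) d n + qNum (a + d) d (n - a) ≤ qNum a d n := by
  unfold qNum
  rw [← Nat.card_sum]
  let insertPart (p : (n - a).Partition) : n.Partition :=
    { parts := a ::ₘ p.parts
      parts_pos := by
        intro i hi
        rcases Multiset.mem_cons.1 hi with rfl | hi
        · exact ha
        · exact p.parts_pos hi
      parts_sum := by rw [Multiset.sum_cons, p.parts_sum]; omega }
  refine Nat.card_le_card_of_injective (Sum.elim
    (fun p => ⟨p.1, fun x hx => (Nat.le_succ a).trans (p.2.1 x hx), p.2.2⟩)
    (fun p => ⟨insertPart p.1, ?_, ?_⟩)) ?_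
  · intro x hx
    rcases Multiset.mem_cons.1 hx with rfl | hx
    · exact le_rfl
    · exact (Nat.le_add_right a d).trans (p.2.1 x hx)
  · obtain ⟨l, hl, hpw⟩ := p.2.2
    refine ⟨a :: l, by rw [← Multiset.cons_coe, ← hl], List.pairwise_cons.2 ⟨?_, hpw⟩⟩
    intro x hx
    have := p.2.1 x (by rw [hl]; exact hx)
    omega
  · rintro (⟨p, hp⟩ | ⟨p, hp⟩) (⟨q, hq⟩ | ⟨q, hq⟩) h
    · simpa using h
    · have h' : p.parts = a ::ₘ q.parts := congrArg (fun r => r.1.parts) h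
      have := hp.1 a (by rw [h']; exact Multiset.mem_cons_self _ _)
      omega
    · have h' : a ::ₘ p.parts = q.parts := congrArg (fun r => r.1.parts) h
      have := hq.1 a (by rw [← h']; exact Multiset.mem_cons_self _ _)
      omega
    · have h' : a ::ₘ p.parts = a ::ₘ q.parts := congrArg (fun r => r.1.parts) h
      have : p = q := Nat.Partition.ext ((Multiset.cons_inj_right a).1 h')
      subst this
      rfl

theorem one_le_qNum_s6 {a d n : ℕ} (ha : 1 ≤ a) (han : a ≤ n) : 1 ≤ qNum a d n := by
  have hn : n ≠ 0 := by omega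
  refine Nat.card_pos_iff.2 ⟨⟨⟨Nat.Partition.indiscrete n, ?_, ?_⟩⟩, inferInstance⟩
  · intro x hx
    rw [Nat.Partition.indiscrete_parts hn, Multiset.mem_singleton] at hx
    omega
  · rw [Nat.Partition.indiscrete_parts hn]
    exact ⟨[n], rfl, List.pairwise_singleton _ _⟩

theorem sum_qNum_le {d n : ℕ} (hd : 1 ≤ d) (G : ℕ) {a : ℕ} (ha : 1 ≤ a) (h : a + G ≤ n) :
    ∑ g ∈ Finset.range (G + 1), qNum (a + g + d) d (n - (a + g)) ≤ qNum a d n := by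
  induction G generalizing a with
  | zero =>
    have := qNum_succ_add_le ha hd (n := n) (by omega)
    simp
    omega
  | succ G ih =>
    have h1 := qNum_succ_add_le ha hd (n := n) (by omega)
    have h2 := ih (a := a + 1) (by omega) (by omega)
    rw [Finset.sum_range_succ']
    simp only [add_zero]
    have h3 : ∑ g ∈ Finset.range (G + 1), qNum (a + (g + 1) + d) d (n - (a + (g + 1))) =
        ∑ g ∈ Finset.range (G + 1), qNum (a + 1 + g + d) d (n - (a + 1 + g)) := by
      refine Finset.sum_congr rfl fun g _ => ?_
      rw [show a + (g + 1) = a + 1 + g by ring]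
    omega

/-- Choosing the `m` smallest gaps freely in a box, and letting the largest part absorb the
rest, produces many `d`-distinct partitions of `n` with `m + 1` parts. -/
theorem prod_le_qNum {d B : ℕ} (hd : 1 ≤ d) (m : ℕ) {a n : ℕ} (ha : 1 ≤ a)
    (h : 2 * ((m + 1) * a) + d * (m * (m + 1)) + 2 * (m * B) ≤ 2 * n) :
    ∏ i ∈ Finset.range m, (B / (i + 2) + 1) ≤ qNum a d n := by
  induction m generalizing a n with
  | zero => simpa using one_le_qNum_s6 ha (by omega)
  | succ m ih =>
    have hg : ∀ g ≤ B / (m + 2), (m + 2) * g ≤ B := fun g hg =>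
      (Nat.mul_le_mul_left _ hg).trans (Nat.mul_div_le B (m + 2))
    have hg' : ∀ g ≤ B / (m + 2), a + g ≤ n := fun g hgm => by
      have h1 := hg g hgm
      have h2 : 0 ≤ d * ((m + 1) * (m + 1 + 1)) := Nat.zero_le _
      nlinarith [Nat.zero_le (m * a), Nat.zero_le (m * B), Nat.zero_le (m * g)]
    rw [Finset.prod_range_succ]
    refine le_trans ?_ (sum_qNum_le hd (B / (m + 2)) ha (hg' _ le_rfl))
    calc _ = ∑ g ∈ Finset.range (B / (m + 2) + 1), ∏ i ∈ Finset.range m, (B / (i + 2) + 1) := by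
          rw [Finset.sum_const, Finset.card_range, smul_eq_mul, mul_comm]
      _ ≤ _ := by
          refine Finset.sum_le_sum fun g hgm => ih (by omega) ?_
          have hgB : g ≤ B / (m + 2) := Nat.lt_succ_iff.1 (Finset.mem_range.1 hgm)
          have h1 := hg g hgB
          obtain ⟨c, rfl⟩ := Nat.exists_eq_add_of_le (hg' g hgB)
          rw [Nat.add_sub_cancel_left]
          nlinarith

theorem pow_le_prod_mul_factorial (B m : ℕ) :
    B ^ m ≤ (∏ i ∈ Finset.range m, (B / (i + 2) + 1)) * (m + 1).factorial := by
  induction m with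
  | zero => simp
  | succ m ih =>
    have h : B ≤ (B / (m + 2) + 1) * (m + 2) := by
      rw [mul_comm]; exact (Nat.lt_mul_div_succ B (by omega)).le
    rw [Finset.prod_range_succ, Nat.factorial_succ (m + 1), pow_succ]
    calc _ ≤ _ := Nat.mul_le_mul ih h
      _ = _ := by ring

/-- The multisets of total size at most `N` of positive integers in two colours, given by their
multiplicity functions; the index `(i, b)` stands for the integer `i + 1` in colour `b`. -/
def twoColoured (N : ℕ) : Finset (Fin N × Bool → ℕ) :=
  {f ∈ Fintype.piFinset fun _ => Finset.range (N + 1) | ∑ x, (x.1.val + 1) * f x ≤ N}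

/-- The positive integers other than `1` that are `±1` modulo `d + 1`. -/
def shiftedPart (d : ℕ) {N : ℕ} (x : Fin N × Bool) : ℕ :=
  x.1.val * (d + 1) + d + if x.2 then 2 else 0

theorem shiftedPart_injective {d N : ℕ} (hd : 2 ≤ d) :
    Function.Injective (shiftedPart d (N := N)) := by
  rintro ⟨x, b⟩ ⟨y, c⟩ h
  simp only [shiftedPart] at h
  rcases lt_trichotomy x.val y.val with hxy | hxy | hxy
  · have : (x.val + 1) * (d + 1) ≤ y.val * (d + 1) := Nat.mul_le_mul_right _ hxy
    rw [add_mul] at this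
    split_ifs at h <;> omega
  · rw [hxy] at h
    have : b = c := by cases b <;> cases c <;> simp at h ⊢
    rw [this, Fin.ext hxy]
  · have : (y.val + 1) * (d + 1) ≤ x.val * (d + 1) := Nat.mul_le_mul_right _ hxy
    rw [add_mul] at this
    split_ifs at h <;> omega

theorem sum_shiftedPart_mul_count_le {d N : ℕ} (hd : 2 ≤ d) (s : Multiset ℕ) :
    ∑ x : Fin N × Bool, shiftedPart d x * s.count (shiftedPart d x) ≤ s.sum := by
  classical
  rw [Finset.sum_multiset_count]
  calc _ = ∑ y ∈ Finset.univ.image (shiftedPart d (N := N)), s.count y • y := by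
        rw [Finset.sum_image fun _ _ _ _ h => shiftedPart_injective hd h]
        exact Finset.sum_congr rfl fun _ _ => by rw [smul_eq_mul, mul_comm]
    _ ≤ ∑ y ∈ Finset.univ.image (shiftedPart d (N := N)) ∪ s.toFinset, s.count y • y :=
        Finset.sum_le_sum_of_subset Finset.subset_union_left
    _ = _ := by
        refine (Finset.sum_subset Finset.subset_union_right fun y _ hy => ?_).symm
        rw [Multiset.count_eq_zero_of_notMem (by simpa using hy), zero_smul]

theorem sum_mul_count_shiftedPart_le {d : ℕ} (hd : 2 ≤ d) {n : ℕ} (p : n.Partition) :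
    ∑ x : Fin (n / d) × Bool, (x.1.val + 1) * p.parts.count (shiftedPart d x) ≤ n / d := by
  rw [Nat.le_div_iff_mul_le (by omega), Finset.sum_mul]
  refine le_trans (Finset.sum_le_sum fun x _ => ?_)
    ((sum_shiftedPart_mul_count_le hd p.parts).trans_eq p.parts_sum)
  rw [mul_right_comm]
  refine Nat.mul_le_mul_right _ ?_
  rw [add_mul, one_mul, shiftedPart, mul_add, mul_one]
  omega

theorem exists_shiftedPart_eq {d n y : ℕ} (hd : 2 ≤ d) (hy : y ≠ 1) (hyn : y ≤ n) (hy0 : 0 < y)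
    (h : y % (d + 1) = 1 % (d + 1) ∨ (y + 1) % (d + 1) = 0) :
    ∃ x : Fin (n / d) × Bool, shiftedPart d x = y := by
  rcases h with h | h
  · rw [Nat.mod_eq_of_lt (by omega : 1 < d + 1)] at h
    have h1 := Nat.div_add_mod y (d + 1)
    rcases hk : y / (d + 1) with _ | k
    · rw [hk] at h1; omega
    · rw [hk, h] at h1
      refine ⟨(⟨k, (Nat.le_div_iff_mul_le (by omega)).2 ?_⟩, true), ?_⟩
      · rw [Nat.succ_eq_add_one]; nlinarith
      · simp only [shiftedPart, if_true]; rw [← h1]; ring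
  · have h1 := Nat.div_add_mod (y + 1) (d + 1)
    rcases hk : (y + 1) / (d + 1) with _ | k
    · rw [hk] at h1; omega
    · rw [hk, h] at h1
      refine ⟨(⟨k, (Nat.le_div_iff_mul_le (by omega)).2 ?_⟩, false), ?_⟩
      · rw [Nat.succ_eq_add_one]; nlinarith
      · simp only [shiftedPart, Bool.false_eq_true, if_false]; nlinarith

theorem QNum_le_card_twoColoured {d : ℕ} (hd : 2 ≤ d) (n : ℕ) :
    QNum 1 (d - 2) n ≤ (twoColoured (n / d)).card := by
  unfold QNum
  rw [show d - 2 + 3 = d + 1 by omega, ← Nat.card_eq_finsetCard (twoColoured (n / d))]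
  refine Nat.card_le_card_of_injective
    (fun p => ⟨fun x => p.1.parts.count (shiftedPart d x), ?_⟩) ?_
  · have h := sum_mul_count_shiftedPart_le hd p.1
    refine Finset.mem_filter.2 ⟨Fintype.mem_piFinset.2 fun x => Finset.mem_range.2 ?_, h⟩
    refine Nat.lt_succ_of_le (le_trans ?_ ((Finset.single_le_sum
      (fun _ _ => Nat.zero_le _) (Finset.mem_univ x)).trans h))
    exact Nat.le_mul_of_pos_left _ (Nat.succ_pos _)
  · rintro ⟨p, hp⟩ ⟨q, hq⟩ h
    have hcount : ∀ x : Fin (n / d) × Bool,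
        p.parts.count (shiftedPart d x) = q.parts.count (shiftedPart d x) :=
      fun x => congrFun (congrArg Subtype.val h) x
    have key : ∀ y, y ≠ 1 → p.parts.count y = q.parts.count y := by
      intro y hy
      by_cases hmem : y ∈ p.parts ∨ y ∈ q.parts
      · obtain ⟨x, rfl⟩ : ∃ x : Fin (n / d) × Bool, shiftedPart d x = y := by
          rcases hmem with hmem | hmem
          · exact exists_shiftedPart_eq hd hy (p.le_of_mem_parts hmem) (p.parts_pos hmem)
              (hp y hmem)
          · exact exists_shiftedPart_eq hd hy (q.le_of_mem_parts hmem) (q.parts_pos hmem)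
              (hq y hmem)
        exact hcount x
      · push Not at hmem
        rw [Multiset.count_eq_zero_of_notMem hmem.1, Multiset.count_eq_zero_of_notMem hmem.2]
    have hfilter : p.parts.filter (fun y => ¬ 1 = y) = q.parts.filter (fun y => ¬ 1 = y) := by
      ext y
      rw [Multiset.count_filter, Multiset.count_filter]
      split_ifs with hy
      · rfl
      · exact key y fun h => hy h.symm
    have hsum : ∀ r : n.Partition,
        r.parts.count 1 + (r.parts.filter (fun y => ¬ 1 = y)).sum = n := by
      intro r
      conv_rhs => rw [← r.parts_sum, ← Multiset.filter_add_not (fun y => 1 = y) r.parts]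
      rw [Multiset.sum_add, Multiset.filter_eq, Multiset.sum_replicate, smul_eq_mul, mul_one]
    refine Subtype.ext (Nat.Partition.ext (Multiset.ext.2 fun y => ?_))
    by_cases hy : y = 1
    · have h1 := hsum p
      have h2 := hsum q
      rw [hfilter] at h1
      subst hy
      change p.parts.count 1 = q.parts.count 1
      omega
    · exact key y hy

theorem card_twoColoured_one : (twoColoured 1).card = 3 := by
  decide

/-- Rankin's bound for the number of two-coloured multisets. -/
theorem card_twoColoured_le {x : ℝ} (hx0 : 0 < x) (hx1 : x < 1) (N : ℕ) :
    ((twoColoured N).card : ℝ) ≤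
      (x ^ N)⁻¹ * (∏ i ∈ Finset.range N, (1 - x ^ (i + 1))⁻¹) ^ 2 := by
  have hpow : ∀ i : ℕ, x ^ (i + 1) < 1 := fun i => pow_lt_one₀ hx0.le hx1 (by omega)
  have hprod : ∏ y : Fin N × Bool, ∑ j ∈ Finset.range (N + 1), x ^ ((y.1.val + 1) * j) ≤
      (∏ i ∈ Finset.range N, (1 - x ^ (i + 1))⁻¹) ^ 2 := by
    calc _ ≤ ∏ y : Fin N × Bool, (1 - x ^ (y.1.val + 1))⁻¹ := by
          refine Finset.prod_le_prod (fun _ _ => Finset.sum_nonneg fun _ _ => by positivity)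
            fun y _ => ?_
          simp only [pow_mul]
          rw [← tsum_geometric_of_lt_one (by positivity) (hpow _)]
          exact (summable_geometric_of_lt_one (by positivity) (hpow _)).sum_le_tsum _
            fun _ _ => by positivity
      _ = _ := by
          rw [Fintype.prod_prod_type, ← Finset.prod_pow,
            ← Fin.prod_univ_eq_prod_range (fun i => ((1 - x ^ (i + 1))⁻¹) ^ 2)]
          exact Finset.prod_congr rfl fun _ _ => by rw [Fintype.prod_bool, sq]
  rw [inv_mul_eq_div, le_div_iff₀ (by positivity)]
  refine le_trans ?_ hprod
  rw [Finset.prod_univ_sum]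
  calc _ = ∑ f ∈ twoColoured N, x ^ N := by rw [Finset.sum_const, nsmul_eq_mul]
    _ ≤ ∑ f ∈ twoColoured N, ∏ y, x ^ ((y.1.val + 1) * f y) := by
        refine Finset.sum_le_sum fun f hf => ?_
        rw [Finset.prod_pow_eq_pow_sum]
        exact pow_le_pow_of_le_one hx0.le hx1.le (Finset.mem_filter.1 hf).2
    _ ≤ _ := Finset.sum_le_sum_of_subset_of_nonneg (Finset.filter_subset _ _)
        fun _ _ _ => Finset.prod_nonneg fun _ _ => by positivity

theorem neg_log_one_sub_exp_sum_le {u : ℝ} (hu : 0 < u) (N : ℕ) :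
    ∑ i ∈ Finset.range N, -Real.log (1 - Real.exp (-u) ^ (i + 1)) ≤
      Real.pi ^ 2 / 6 / u := by
  have hx1 : Real.exp (-u) < 1 := Real.exp_lt_one_iff.2 (by linarith)
  have hx0 := Real.exp_pos (-u)
  have h1 := hasSum_sum fun i (_ : i ∈ Finset.range N) =>
    Real.hasSum_pow_div_log_of_abs_lt_one (x := Real.exp (-u) ^ (i + 1)) (by
      rw [abs_of_pos (by positivity)]
      exact pow_lt_one₀ hx0.le hx1 (by omega))
  have h2 := ((hasSum_nat_add_iff' 1).2 hasSum_zeta_two).div_const u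
  simp only [Finset.sum_range_one, Nat.cast_zero, ne_eq, OfNat.ofNat_ne_zero, not_false_eq_true,
    zero_pow, div_zero, sub_zero] at h2
  refine hasSum_le (fun l => ?_) h1 h2
  have hl : (0 : ℝ) < (l : ℝ) + 1 := by positivity
  set y := Real.exp (-u) ^ (l + 1) with hy
  have hy0 : 0 < y := by positivity
  have hy1 : y < 1 := pow_lt_one₀ hx0.le hx1 (by omega)
  have hgeom : ∑ i ∈ Finset.range N, y ^ (i + 1) ≤ y / (1 - y) := by
    simp only [pow_succ']
    rw [← Finset.mul_sum, div_eq_mul_inv, ← tsum_geometric_of_lt_one hy0.le hy1]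
    exact mul_le_mul_of_nonneg_left ((summable_geometric_of_lt_one hy0.le hy1).sum_le_tsum _
      fun _ _ => by positivity) hy0.le
  have hyu : y / (1 - y) ≤ 1 / (u * (l + 1)) := by
    rw [div_le_div_iff₀ (by linarith) (by positivity)]
    have h3 : y * Real.exp (u * (l + 1)) = 1 := by
      rw [hy, ← Real.exp_nat_mul, ← Real.exp_add]
      simp
      ring
    have h4 := Real.add_one_le_exp (u * (l + 1))
    nlinarith [mul_le_mul_of_nonneg_left h4 hy0.le]
  calc _ = (∑ i ∈ Finset.range N, y ^ (i + 1)) / (l + 1) := by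
        rw [Finset.sum_div]
        refine Finset.sum_congr rfl fun i _ => ?_
        rw [hy, ← pow_mul, ← pow_mul, mul_comm]
    _ ≤ 1 / (u * (l + 1)) / (l + 1) := by
        gcongr
        exact hgeom.trans hyu
    _ = _ := by
        push_cast
        field_simp

theorem exp_forty_le : Real.exp 40 ≤ 38 ^ 11 := by
  rw [show (40 : ℝ) = (40 : ℕ) * 1 by norm_num, Real.exp_nat_mul]
  exact (pow_le_pow_left₀ (Real.exp_pos _).le Real.exp_one_lt_d9.le 40).trans (by norm_num)

/-- Hardy-Ramanujan type bound for the number of two-coloured multisets. -/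
theorem card_twoColoured_le_pow {k N : ℕ} (hk : 0 < k) (hN : N ≤ k ^ 2) :
    (twoColoured N).card ≤ 38 ^ k := by
  have hk' : (0 : ℝ) < k := by exact_mod_cast hk
  set u : ℝ := 9 / (5 * k) with hu
  have hu0 : 0 < u := by positivity
  have hx1 : Real.exp (-u) < 1 := Real.exp_lt_one_iff.2 (by linarith)
  have hx0 := Real.exp_pos (-u)
  have h1 := card_twoColoured_le hx0 hx1 N
  have h2 : ∏ i ∈ Finset.range N, (1 - Real.exp (-u) ^ (i + 1))⁻¹ ≤
      Real.exp (Real.pi ^ 2 / 6 / u) := by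
    refine le_trans (le_of_eq ?_) (Real.exp_le_exp.2 (neg_log_one_sub_exp_sum_le hu0 N))
    rw [Real.exp_sum]
    refine Finset.prod_congr rfl fun i _ => ?_
    rw [Real.exp_neg (Real.log _), Real.exp_log]
    exact sub_pos.2 (pow_lt_one₀ hx0.le hx1 (by omega))
  have h3 : (Real.exp (-u) ^ N)⁻¹ = Real.exp (N * u) := by
    rw [← Real.exp_nat_mul, ← Real.exp_neg]
    congr 1
    ring
  have h4 : N * u + 2 * (Real.pi ^ 2 / 6 / u) ≤ 40 / 11 * k := by
    have h5 : N * u ≤ 9 / 5 * k := by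
      have : (N : ℝ) ≤ k ^ 2 := by exact_mod_cast hN
      calc N * u ≤ k ^ 2 * u := by gcongr
        _ = _ := by rw [hu]; field_simp
    have h6 : 2 * (Real.pi ^ 2 / 6 / u) = Real.pi ^ 2 * (5 / 27) * k := by
      rw [hu]; field_simp; ring
    have h7 : Real.pi ^ 2 ≤ 3.1416 ^ 2 :=
      pow_le_pow_left₀ Real.pi_pos.le Real.pi_lt_d4.le 2
    rw [h6]
    norm_num at h7
    nlinarith
  have h8 : Real.exp (40 / 11) ≤ 38 := by
    refine le_of_pow_le_pow_left₀ (n := 11) (by norm_num) (by norm_num) ?_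
    rw [← Real.exp_nat_mul]
    norm_num
    exact exp_forty_le.trans (by norm_num)
  have h9 : ((twoColoured N).card : ℝ) ≤ 38 ^ k := by
    calc _ ≤ _ := h1
      _ ≤ Real.exp (N * u) * Real.exp (Real.pi ^ 2 / 6 / u) ^ 2 := by
          rw [h3]
          gcongr
          exact Finset.prod_nonneg fun i _ =>
            (inv_pos.2 (sub_pos.2 (pow_lt_one₀ hx0.le hx1 (by omega)))).le
      _ = Real.exp (N * u + 2 * (Real.pi ^ 2 / 6 / u)) := by
          rw [← Real.exp_nat_mul, ← Real.exp_add]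
          norm_num
      _ ≤ Real.exp (40 / 11 * k) := Real.exp_le_exp.2 h4
      _ = Real.exp (40 / 11) ^ k := by rw [← Real.exp_nat_mul, mul_comm]
      _ ≤ _ := by gcongr
  exact_mod_cast h9

theorem card_twoColoured_two : (twoColoured 2).card = 8 := by
  decide

theorem prod_inv_one_sub_half_pow_le {N : ℕ} (hN : 3 ≤ N) :
    ∏ i ∈ Finset.range N, (1 - (1 / 2 : ℝ) ^ (i + 1))⁻¹ ≤ 7 / 2 * (1 - (1 / 2) ^ N) := by
  induction N, hN using Nat.le_induction with
  | base => norm_num [Finset.prod_range_succ]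
  | succ N _ ih =>
    have ht : (1 / 2 : ℝ) ^ (N + 1) < 1 := pow_lt_one₀ (by norm_num) (by norm_num) (by omega)
    rw [Finset.prod_range_succ, ← div_eq_mul_inv, div_le_iff₀ (sub_pos.2 ht)]
    have hN2 : (1 / 2 : ℝ) ^ N = 2 * (1 / 2) ^ (N + 1) := by ring
    rw [hN2] at ih
    nlinarith [sq_nonneg ((1 / 2 : ℝ) ^ (N + 1))]

theorem four_mul_card_twoColoured_le {N : ℕ} (hN : 3 ≤ N) :
    4 * (twoColoured N).card ≤ 49 * 2 ^ N := by
  have h1 := card_twoColoured_le (x := 1 / 2) (by norm_num) (by norm_num) N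
  have h2 := prod_inv_one_sub_half_pow_le hN
  have h3 : (0 : ℝ) < (1 / 2) ^ N := by positivity
  have h4 : 0 ≤ ∏ i ∈ Finset.range N, (1 - (1 / 2 : ℝ) ^ (i + 1))⁻¹ :=
    Finset.prod_nonneg fun i _ =>
      (inv_pos.2 (sub_pos.2 (pow_lt_one₀ (by norm_num) (by norm_num) (by omega)))).le
  have h5 : (4 * (twoColoured N).card : ℝ) ≤ 49 * 2 ^ N := by
    rw [show ((1 / 2 : ℝ) ^ N)⁻¹ = 2 ^ N by rw [one_div, inv_pow, inv_inv]] at h1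
    have h6 := pow_le_pow_left₀ h4 (h2.trans (by linarith : _ ≤ (7 / 2 : ℝ))) 2
    have h7 := mul_le_mul_of_nonneg_left h6 (by positivity : (0 : ℝ) ≤ 2 ^ N)
    linarith
  exact_mod_cast h5

theorem pow_succ_add_mul_pow_le (c a m : ℕ) :
    c ^ (m + 1) + (m + 1) * a * c ^ m ≤ (c + a) ^ (m + 1) := by
  induction m with
  | zero => simp
  | succ m ih =>
    calc _ ≤ (c ^ (m + 1) + (m + 1) * a * c ^ m) * (c + a) := by
          ring_nf
          omega
      _ ≤ _ := by
          rw [pow_succ (c + a) (m + 1)]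
          exact Nat.mul_le_mul_right _ ih

theorem pow_mul_factorial_le {j : ℕ} (hj : 5 ≤ j) :
    38 ^ (j + 2) * (j + 2).factorial ≤ (64 * j - 2) ^ (j + 1) := by
  induction j, hj using Nat.le_induction with
  | base => norm_num [Nat.factorial]
  | succ j hj ih =>
    obtain ⟨c, hc⟩ : ∃ c, 64 * j - 2 = c := ⟨_, rfl⟩
    have hcj : 64 * (j + 1) - 2 = c + 64 := by omega
    rw [hc] at ih
    rw [hcj, show j + 1 + 2 = (j + 2) + 1 by ring, Nat.factorial_succ]
    have hbern : 2 * c ^ (j + 2) ≤ (c + 64) ^ (j + 2) := by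
      have h1 : c ^ (j + 2) + (j + 2) * 64 * c ^ (j + 1) ≤ (c + 64) ^ (j + 2) :=
        pow_succ_add_mul_pow_le c 64 (j + 1)
      have h2 : c * c ^ (j + 1) ≤ (j + 2) * 64 * c ^ (j + 1) :=
        Nat.mul_le_mul_right _ (by omega)
      rw [pow_succ' c (j + 1)] at h1 ⊢
      omega
    calc 38 ^ (j + 2 + 1) * ((j + 2 + 1) * (j + 2).factorial)
        = 38 * (j + 3) * (38 ^ (j + 2) * (j + 2).factorial) := by ring
      _ ≤ 2 * c * c ^ (j + 1) := Nat.mul_le_mul (by omega) ih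
      _ = 2 * c ^ (j + 2) := by ring
      _ ≤ _ := hbern

theorem card_twoColoured_le_qNum_of_le {d n N : ℕ} (hd : 128 ≤ d) (hn : d * N ≤ n)
    (hN2 : 2 ≤ N) (hN : N ≤ 35) : (twoColoured N).card ≤ qNum 1 d n := by
  have hq := fun m B => prod_le_qNum (B := B) (show 1 ≤ d by omega) m (n := n) le_rfl
  rcases hN2.eq_or_lt with rfl | hN3
  · rw [card_twoColoured_two]
    refine le_trans ?_ (hq 1 126 (by omega))
    decide
  rcases le_or_gt 30 N with hN30 | hN30
  · refine (card_twoColoured_le_pow (k := 6) (by norm_num) (by omega)).trans ?_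
    refine le_trans ?_ (hq 5 382 (by nlinarith))
    simp [Finset.prod_range_succ]
  · have h := four_mul_card_twoColoured_le hN3
    have key : ∀ m B, 2 * ((m + 1) * 1) + d * (m * (m + 1)) + 2 * (m * B) ≤ 2 * n →
        49 * 2 ^ N ≤ 4 * ∏ i ∈ Finset.range m, (B / (i + 2) + 1) →
        (twoColoured N).card ≤ qNum 1 d n := fun m B h1 h2 => by
      have := hq m B h1
      omega
    rcases le_or_gt N 3 with h1 | h1
    · refine key 1 254 ?_ ?_ <;> interval_cases N <;> first | omega | decide
    rcases le_or_gt N 12 with h2 | h2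
    · refine key 2 ((128 * (N - 3) - 3) / 2) ?_ ?_ <;> interval_cases N <;>
        first | omega | norm_num [Finset.prod_range_succ]
    rcases le_or_gt N 19 with h3 | h3
    · refine key 3 ((128 * (N - 6) - 4) / 3) ?_ ?_ <;> interval_cases N <;>
        first | omega | norm_num [Finset.prod_range_succ]
    rcases le_or_gt N 25 with h4 | h4
    · refine key 4 ((128 * (N - 10) - 5) / 4) ?_ ?_ <;> interval_cases N <;>
        first | omega | norm_num [Finset.prod_range_succ]
    · refine key 5 ((128 * (N - 15) - 6) / 5) ?_ ?_ <;> interval_cases N <;>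
        first | omega | norm_num [Finset.prod_range_succ]

theorem card_twoColoured_le_qNum_of_ge {d n N : ℕ} (hd : 128 ≤ d) (hn : d * N ≤ n)
    (hN : 36 ≤ N) : (twoColoured N).card ≤ qNum 1 d n := by
  have hs : 6 ≤ N.sqrt := Nat.le_sqrt.2 (by omega)
  obtain ⟨j, hj⟩ := Nat.exists_eq_add_of_le' (show 1 ≤ N.sqrt by omega)
  have hlow : (j + 1) ^ 2 ≤ N := by rw [← hj]; exact Nat.sqrt_le' N
  have hup : N ≤ (j + 2) ^ 2 := by
    have := Nat.lt_succ_sqrt' N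
    rw [hj] at this
    exact this.le
  refine (card_twoColoured_le_pow (by omega) hup).trans ?_
  have hprod := (pow_mul_factorial_le (show 5 ≤ j by omega)).trans
    (pow_le_prod_mul_factorial (64 * j - 2) (j + 1))
  refine (Nat.le_of_mul_le_mul_right hprod (Nat.factorial_pos _)).trans
    (prod_le_qNum (by omega) (j + 1) le_rfl ?_)
  obtain ⟨c, hc⟩ : ∃ c, 64 * j - 2 = c := ⟨_, rfl⟩
  have hc' : 64 * j = c + 2 := by omega
  rw [hc]
  have h1 : d * (j + 1) ^ 2 ≤ n := (Nat.mul_le_mul_left d hlow).trans hn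
  have h2 : 128 * ((j + 1) * j) ≤ d * ((j + 1) * j) := Nat.mul_le_mul_right _ hd
  have h3 : 128 * ((j + 1) * j) = 2 * ((j + 1) * (c + 2)) := by rw [← hc']; ring
  nlinarith

theorem shift_level_one (d n : ℕ) (hd : 127 < d) (hpow : ∀ r : ℕ, d ≠ 2 ^ r - 1)
    (hn : d + 4 ≤ n) :
    QNum 1 (d - 2) n ≤ qNum 1 d n := by
  have hN : d * (n / d) ≤ n := Nat.mul_div_le n d
  refine (QNum_le_card_twoColoured (by omega) n).trans ?_
  have hN1 : 1 ≤ n / d := (Nat.one_le_div_iff (by omega)).2 (by omega)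
  rcases hN1.eq_or_lt with h1 | h1
  · rw [← h1, card_twoColoured_one]
    have h2 := qNum_succ_add_le (a := 1) (d := d) (n := n) le_rfl (by omega) (by omega)
    have h3 := qNum_succ_add_le (a := 2) (d := d) (n := n) (by omega) (by omega) (by omega)
    have h4 := one_le_qNum_s6 (a := 1 + d) (d := d) (n := n - 1) (by omega) (by omega)
    have h5 := one_le_qNum_s6 (a := 2 + d) (d := d) (n := n - 2) (by omega) (by omega)
    have h6 := one_le_qNum_s6 (a := 3) (d := d) (n := n) (by omega) (by omega)
    norm_num only at h2 h3
    omega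
  · rcases le_or_gt (n / d) 35 with h2 | h2
    · exact card_twoColoured_le_qNum_of_le hd hN h1 h2
    · exact card_twoColoured_le_qNum_of_ge hd hN h2
end
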